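/- The optimal positional strategy for the game of best choice restricted to 321-avoiding interview orders of size N is to transition after position k = N-1 when N = 2, after k = N-2 when 3 ≤ N ≤ 8, and after k = N-3 when N ≥ 9. -/

import Mathlib

def IsLTRMax {N : ℕ} (p : Equiv.Perm (Fin N)) (j : Fin N) : Prop :=
  ∀ i : Fin N, i < j → p i < p j

def Winnable (N k : ℕ) (p : Equiv.Perm (Fin N)) : Prop :=
  ∃ j : Fin N, k ≤ (j : ℕ) ∧ IsLTRMax p j ∧
    (∀ i : Fin N, k ≤ (i : ℕ) → IsLTRMax p i → j ≤ i) ∧ ((p j : ℕ) = N - 1)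

def Avoids321 {N : ℕ} (p : Equiv.Perm (Fin N)) : Prop :=
  ¬ ∃ i j l : Fin N, i < j ∧ j < l ∧ p l < p j ∧ p j < p i

/-- The number of 321-avoiding permutations of size `N` that are `k`-winnable. -/
noncomputable def winCount (N k : ℕ) : ℕ :=
  Nat.card {p : Equiv.Perm (Fin N) // Avoids321 p ∧ Winnable N k p}

section

open Finset

/-- The permutation of `Fin (n + 1)` obtained from `q` by inserting a new maximum at position `j`. -/
def insertMax {n : ℕ} (j : Fin (n + 1)) (q : Equiv.Perm (Fin n)) : Equiv.Perm (Fin (n + 1)) :=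
  (finSuccEquiv' j).trans ((Equiv.optionCongr q).trans (finSuccEquiv' (Fin.last n)).symm)

@[simp] lemma insertMax_self {n : ℕ} (j : Fin (n + 1)) (q : Equiv.Perm (Fin n)) :
    insertMax j q j = Fin.last n := by
  simp [insertMax]

@[simp] lemma insertMax_succAbove {n : ℕ} (j : Fin (n + 1)) (q : Equiv.Perm (Fin n)) (a : Fin n) :
    insertMax j q (j.succAbove a) = (q a).castSucc := by
  simp [insertMax]

lemma insertMax_injective {n : ℕ} (j : Fin (n + 1)) : Function.Injective (insertMax j) := by
  intro q r h
  ext a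
  have := congrArg (fun p => p (j.succAbove a)) h
  simp only [insertMax_succAbove, Fin.castSucc_inj] at this
  rw [this]

lemma exists_insertMax_eq {n : ℕ} (j : Fin (n + 1)) (p : Equiv.Perm (Fin (n + 1)))
    (hp : p j = Fin.last n) : ∃ q, insertMax j q = p := by
  have hne : ∀ a : Fin n, p (j.succAbove a) ≠ Fin.last n := fun a h =>
    Fin.succAbove_ne j a (p.injective (h.trans hp.symm))
  let f : Fin n → Fin n := fun a => (p (j.succAbove a)).castPred (hne a)
  have hf : Function.Injective f := by
    intro a b h
    have h' := (Fin.castPred_inj (hi := hne a) (hj := hne b)).1 h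
    exact Fin.succAbove_right_injective (p.injective h')
  refine ⟨Equiv.ofBijective f (Finite.injective_iff_bijective.1 hf), Equiv.ext fun i => ?_⟩
  rcases Fin.eq_self_or_eq_succAbove j i with rfl | ⟨a, rfl⟩
  · simp [hp]
  · simp [f]

lemma natCard_and_apply_eq_last {n : ℕ} (j : Fin (n + 1)) (P : Equiv.Perm (Fin (n + 1)) → Prop) :
    Nat.card {p // P p ∧ p j = Fin.last n} = Nat.card {q // P (insertMax j q)} := by
  refine (Nat.card_congr (Equiv.ofBijective
    (fun q : {q // P (insertMax j q)} =>
      (⟨insertMax j q.1, q.2, insertMax_self j q.1⟩ : {p // P p ∧ p j = Fin.last n}))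
    ⟨fun q r h => Subtype.ext (insertMax_injective j (congrArg Subtype.val h)), ?_⟩)).symm
  rintro ⟨p, hP, hp⟩
  obtain ⟨q, rfl⟩ := exists_insertMax_eq j p hp
  exact ⟨⟨q, hP⟩, rfl⟩

lemma natCard_eq_add_not {α : Type*} [Fintype α] (P Q : α → Prop) :
    Nat.card {a // P a} = Nat.card {a // P a ∧ Q a} + Nat.card {a // P a ∧ ¬ Q a} := by
  classical
  simp only [Nat.card_eq_fintype_card, Fintype.card_subtype]
  rw [← filter_filter, ← filter_filter, card_filter_add_card_filter_not]

lemma natCard_eq_sum_apply_eq_last {n : ℕ} (P : Equiv.Perm (Fin (n + 1)) → Prop) :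
    Nat.card {p // P p} = ∑ j, Nat.card {p // P p ∧ p j = Fin.last n} := by
  classical
  simp only [Nat.card_eq_fintype_card, Fintype.card_subtype]
  rw [card_eq_sum_card_fiberwise (f := fun p => p.symm (Fin.last n)) (t := univ) (by simp)]
  refine sum_congr rfl fun j _ => ?_
  rw [filter_filter]
  congr 1
  ext p
  simp [Equiv.symm_apply_eq, eq_comm (a := p j)]

lemma val_lt_of_succAbove_lt {n : ℕ} {j : Fin (n + 1)} {a : Fin n}
    (h : j.succAbove a < j) : (a : ℕ) < j := by
  simpa [Fin.lt_def] using (Fin.succAbove_lt_iff_castSucc_lt j a).1 h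

lemma val_succAbove_of_lt {n : ℕ} {j : Fin (n + 1)} {a : Fin n} (h : (a : ℕ) < j) :
    (j.succAbove a : ℕ) = a := by
  rw [Fin.succAbove_of_castSucc_lt j a (by simpa [Fin.lt_def] using h)]; simp

lemma val_succAbove_of_le {n : ℕ} {j : Fin (n + 1)} {a : Fin n} (h : (j : ℕ) ≤ a) :
    (j.succAbove a : ℕ) = a + 1 := by
  rw [Fin.succAbove_of_le_castSucc j a (by simpa [Fin.le_def] using h)]; simp

lemma avoids321_insertMax {n : ℕ} (j : Fin (n + 1)) (q : Equiv.Perm (Fin n)) :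
    Avoids321 (insertMax j q) ↔
      Avoids321 q ∧ ∀ a b : Fin n, (j : ℕ) ≤ a → a < b → q a < q b := by
  constructor
  · intro h
    refine ⟨?_, ?_⟩
    · rintro ⟨a, b, c, hab, hbc, h1, h2⟩
      refine h ⟨j.succAbove a, j.succAbove b, j.succAbove c, ?_, ?_, ?_, ?_⟩ <;> simpa
    · intro a b hja hab
      by_contra hlt
      have hba : q b < q a := lt_of_le_of_ne (not_lt.1 hlt) fun h => hab.ne' (q.injective h)
      refine h ⟨j, j.succAbove a, j.succAbove b, ?_, by simpa, by simpa, by simp⟩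
      rw [Fin.lt_def, val_succAbove_of_le hja]
      omega
  · rintro ⟨h, hinc⟩ ⟨a, b, c, hab, hbc, h1, h2⟩
    rcases Fin.eq_self_or_eq_succAbove j b with rfl | ⟨b, rfl⟩
    · simp only [insertMax_self] at h2
      exact absurd (Fin.le_last _) (not_le.2 h2)
    rcases Fin.eq_self_or_eq_succAbove j c with rfl | ⟨c, rfl⟩
    · simp only [insertMax_self] at h1
      exact absurd (Fin.le_last _) (not_le.2 h1)
    simp only [insertMax_succAbove, Fin.castSucc_lt_castSucc_iff, Fin.succAbove_lt_succAbove_iff]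
      at h1 hbc
    rcases Fin.eq_self_or_eq_succAbove j a with rfl | ⟨a, rfl⟩
    · have : (a : ℕ) ≤ b := by
        by_contra hlt
        rw [Fin.lt_def, val_succAbove_of_lt (not_le.1 hlt)] at hab
        omega
      exact absurd (hinc b c this hbc) (not_lt.2 h1.le)
    · simp only [insertMax_succAbove, Fin.castSucc_lt_castSucc_iff,
        Fin.succAbove_lt_succAbove_iff] at h2 hab
      exact h ⟨a, b, c, hab, hbc, h1, h2⟩

lemma isLTRMax_of_apply_eq_last {n : ℕ} {p : Equiv.Perm (Fin (n + 1))} {j : Fin (n + 1)}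
    (h : p j = Fin.last n) : IsLTRMax p j := by
  intro i hi
  rw [h]
  exact Fin.lt_last_iff_ne_last.2 fun hp => hi.ne (p.injective (hp.trans h.symm))

lemma not_isLTRMax_of_lt {n : ℕ} {p : Equiv.Perm (Fin (n + 1))} {i j : Fin (n + 1)}
    (h : p j = Fin.last n) (hji : j < i) : ¬ IsLTRMax p i := fun hi =>
  absurd (hi j hji) (not_lt.2 (h ▸ Fin.le_last _))

lemma isLTRMax_insertMax {n : ℕ} {j : Fin (n + 1)} {q : Equiv.Perm (Fin n)} {a : Fin n}
    (ha : (a : ℕ) < j) : IsLTRMax (insertMax j q) (j.succAbove a) ↔ IsLTRMax q a := by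
  constructor
  · intro h i hi
    simpa using h (j.succAbove i) (by simpa)
  · intro h i hi
    rcases Fin.eq_self_or_eq_succAbove j i with rfl | ⟨i, rfl⟩
    · rw [Fin.lt_def, val_succAbove_of_lt ha] at hi
      omega
    · simpa using h i (by simpa using hi)

lemma forall_not_isLTRMax_insertMax {n : ℕ} (k m : ℕ) (j : Fin (n + 1)) (hm : m ≤ j)
    (q : Equiv.Perm (Fin n)) :
    (∀ i : Fin (n + 1), k ≤ (i : ℕ) → (i : ℕ) < m → ¬ IsLTRMax (insertMax j q) i) ↔
      ∀ i : Fin n, k ≤ (i : ℕ) → (i : ℕ) < m → ¬ IsLTRMax q i := by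
  constructor
  · intro h i hk hi
    have hij : (i : ℕ) < j := by omega
    rw [← isLTRMax_insertMax hij]
    exact h _ (by rwa [val_succAbove_of_lt hij]) (by rwa [val_succAbove_of_lt hij])
  · intro h i hk hi
    rcases Fin.eq_self_or_eq_succAbove j i with rfl | ⟨i, rfl⟩
    · omega
    · have hij : (i : ℕ) < j := val_lt_of_succAbove_lt (Fin.lt_def.2 (by omega))
      rw [val_succAbove_of_lt hij] at hk hi
      rw [isLTRMax_insertMax hij]
      exact h i hk hi

/-- `p` avoids `321`, has no left-to-right maximum at a position in `[k, j)`, and is increasing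
from position `j` on. -/
def IsTail {n : ℕ} (k j : ℕ) (p : Equiv.Perm (Fin n)) : Prop :=
  Avoids321 p ∧ (∀ i : Fin n, k ≤ (i : ℕ) → (i : ℕ) < j → ¬ IsLTRMax p i) ∧
    ∀ a b : Fin n, j ≤ (a : ℕ) → a < b → p a < p b

noncomputable def tailCount (n k j : ℕ) : ℕ :=
  Nat.card {p : Equiv.Perm (Fin n) // IsTail k j p}

lemma winnable_and_apply_eq_last_iff {n : ℕ} (k : ℕ) (p : Equiv.Perm (Fin (n + 1)))
    (j : Fin (n + 1)) (hj : p j = Fin.last n) :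
    Winnable (n + 1) k p ↔
      k ≤ (j : ℕ) ∧ ∀ i : Fin (n + 1), k ≤ (i : ℕ) → (i : ℕ) < j → ¬ IsLTRMax p i := by
  constructor
  · rintro ⟨l, hkl, -, hmin, hl⟩
    have : l = j := p.injective (by rw [hj]; ext; simpa using hl)
    subst this
    exact ⟨hkl, fun i hk hi hmax => absurd (hmin i hk hmax) (not_le.2 (Fin.lt_def.2 hi))⟩
  · rintro ⟨hk, h⟩
    refine ⟨j, hk, isLTRMax_of_apply_eq_last hj, fun i hki hi => ?_, by simp [hj]⟩
    by_contra hlt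
    exact h i hki (Fin.lt_def.1 (not_le.1 hlt)) hi

lemma winCount_succ (n k : ℕ) :
    winCount (n + 1) k = ∑ j ∈ range (n + 1), if k ≤ j then tailCount n k j else 0 := by
  rw [winCount, natCard_eq_sum_apply_eq_last,
    ← Fin.sum_univ_eq_sum_range (fun j => if k ≤ j then tailCount n k j else 0)]
  refine sum_congr rfl fun j _ => ?_
  rw [natCard_and_apply_eq_last]
  have key (q : Equiv.Perm (Fin n)) :
      (Avoids321 (insertMax j q) ∧ Winnable (n + 1) k (insertMax j q)) ↔
        k ≤ (j : ℕ) ∧ IsTail k j q := by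
    rw [avoids321_insertMax, winnable_and_apply_eq_last_iff k _ j (insertMax_self j q),
      forall_not_isLTRMax_insertMax k j j le_rfl, IsTail]
    tauto
  simp only [key]
  split_ifs with h
  · simp [h, tailCount]
  · simp [h]

lemma tailCount_succ {n k j : ℕ} (hkj : k ≤ j) (hj : j ≤ n) :
    tailCount (n + 1) k j = tailCount (n + 1) k (n + 1) + tailCount n k j := by
  rw [tailCount, natCard_eq_add_not _ (fun p => p (Fin.last n) = Fin.last n), add_comm,
    natCard_and_apply_eq_last]
  congr 1
  · refine Nat.card_congr (Equiv.subtypeEquivRight fun p => ⟨?_, ?_⟩)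
    · rintro ⟨⟨hav, hmax, hinc⟩, hlast⟩
      refine ⟨hav, fun i hki _ hi => ?_, fun a b ha => by omega⟩
      by_cases hij : (i : ℕ) < j
      · exact hmax i hki hij hi
      · apply hlast
        obtain ⟨m, hm⟩ := p.surjective (Fin.last n)
        have him : i ≤ m := by
          by_contra hlt
          exact not_isLTRMax_of_lt hm (not_le.1 hlt) hi
        rcases (Fin.le_last m).eq_or_lt with rfl | hml
        · exact hm
        · have := hinc m (Fin.last n) (by rw [Fin.le_def] at him; omega) hml
          rw [hm] at this
          exact absurd this (not_lt.2 (Fin.le_last _))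
    · rintro ⟨hav, hmax, -⟩
      refine ⟨⟨hav, fun i hki _ => hmax i hki i.2, fun a b ha hab => ?_⟩, fun hlast =>
        hmax (Fin.last n) (by simp; omega) (by simp) (isLTRMax_of_apply_eq_last hlast)⟩
      by_contra hlt
      have hba : p b < p a := lt_of_le_of_ne (not_lt.1 hlt) fun h => hab.ne' (p.injective h)
      have hna := hmax a (by omega) a.2
      simp only [IsLTRMax, not_forall, not_lt] at hna
      obtain ⟨c, hca, hc⟩ := hna
      exact hav ⟨c, a, b, hca, hab, hba,
        lt_of_le_of_ne hc fun h => hca.ne' (p.injective h)⟩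
  · refine Nat.card_congr (Equiv.subtypeEquivRight fun q => ?_)
    rw [IsTail, IsTail, avoids321_insertMax,
      forall_not_isLTRMax_insertMax k j (Fin.last n) (by simpa)]
    constructor
    · rintro ⟨⟨hav, -⟩, hmax, hinc⟩
      refine ⟨hav, hmax, fun a b ha hab => ?_⟩
      have := hinc a.castSucc b.castSucc (by simpa) (by simpa)
      rw [← Fin.succAbove_last_apply, ← Fin.succAbove_last_apply] at this
      simpa only [insertMax_succAbove, Fin.castSucc_lt_castSucc_iff] using this
    · rintro ⟨hav, hmax, hinc⟩
      refine ⟨⟨hav, fun a b ha => absurd ha (by simp)⟩, hmax, fun a b ha hab => ?_⟩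
      have hal : a ≠ Fin.last n := (hab.trans_le (Fin.le_last b)).ne
      rcases Fin.eq_self_or_eq_succAbove (Fin.last n) b with rfl | ⟨b, rfl⟩
      · exact isLTRMax_of_apply_eq_last (insertMax_self _ q) a hab
      rcases Fin.eq_self_or_eq_succAbove (Fin.last n) a with rfl | ⟨a, rfl⟩
      · exact absurd rfl hal
      simp only [insertMax_succAbove, Fin.castSucc_lt_castSucc_iff]
      exact hinc a b (by simpa using ha) (by simpa using hab)

lemma tailCount_succ_succ {n k : ℕ} (hk : k ≤ n) :
    tailCount (n + 1) (k + 1) (n + 1) = tailCount (n + 1) k (n + 1) + tailCount n k k := by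
  let j : Fin (n + 1) := ⟨k, by omega⟩
  rw [tailCount, natCard_eq_add_not _ (fun p => p j = Fin.last n), add_comm,
    natCard_and_apply_eq_last]
  congr 1
  · refine Nat.card_congr (Equiv.subtypeEquivRight fun p => ⟨?_, ?_⟩)
    · rintro ⟨⟨hav, hmax, hinc⟩, hlast⟩
      refine ⟨hav, fun i hki hin hi => ?_, hinc⟩
      rcases hki.eq_or_lt with h | h
      · have hij : i = j := Fin.ext h.symm
        subst hij
        obtain ⟨m, hm⟩ := p.surjective (Fin.last n)
        rcases lt_trichotomy m j with h' | h' | h'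
        · exact not_isLTRMax_of_lt hm h' hi
        · exact hlast (h' ▸ hm)
        · exact hmax m (Fin.lt_def.1 h') m.2 (isLTRMax_of_apply_eq_last hm)
      · exact hmax i h hin hi
    · rintro ⟨hav, hmax, hinc⟩
      exact ⟨⟨hav, fun i hki => hmax i (by omega), hinc⟩,
        fun hlast => hmax j le_rfl j.2 (isLTRMax_of_apply_eq_last hlast)⟩
  · refine Nat.card_congr (Equiv.subtypeEquivRight fun q => ?_)
    rw [IsTail, IsTail, avoids321_insertMax]
    constructor
    · rintro ⟨⟨hav, hinc⟩, -⟩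
      exact ⟨hav, fun i _ _ => by omega, hinc⟩
    · rintro ⟨hav, -, hinc⟩
      exact ⟨⟨hav, hinc⟩, fun i hki _ => not_isLTRMax_of_lt (insertMax_self j q)
        (Fin.lt_def.2 hki), fun a b ha => by omega⟩

lemma tailCount_zero : tailCount 0 0 0 = 1 := by
  have : Unique {p : Equiv.Perm (Fin 0) // IsTail 0 0 p} :=
    { default := ⟨1, fun ⟨i, _⟩ => i.elim0, fun i => i.elim0, fun i => i.elim0⟩
      uniq := fun _ => Subsingleton.elim _ _ }
  exact Nat.card_unique

lemma tailCount_succ_zero (n : ℕ) : tailCount (n + 1) 0 (n + 1) = 0 := by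
  have : IsEmpty {p : Equiv.Perm (Fin (n + 1)) // IsTail 0 (n + 1) p} :=
    ⟨fun p => p.2.2.1 0 (Nat.zero_le _) (by simp) fun i hi => absurd hi (Fin.not_lt_zero i)⟩
  exact Nat.card_of_isEmpty

/-- The ballot numbers, by the recursion satisfied by `tailCount (k + d) k (k + d)`. -/
def ballot : ℕ → ℕ → ℕ
  | 0, 0 => 1
  | 0, _ + 1 => 0
  | k + 1, d => ∑ e ∈ range (d + 2), ballot k e

lemma tailCount_eq_sum (k j d : ℕ) (hkj : k ≤ j) :
    tailCount (j + d) k j = ∑ e ∈ range (d + 1), tailCount (j + e) k (j + e) := by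
  induction d with
  | zero => simp
  | succ d ih =>
    rw [sum_range_succ, ← ih, ← add_assoc, tailCount_succ hkj (by omega), add_comm]

lemma tailCount_eq_ballot (k d : ℕ) : tailCount (k + d) k (k + d) = ballot k d := by
  induction k generalizing d with
  | zero =>
    cases d with
    | zero => simpa [ballot] using tailCount_zero
    | succ d => simpa [ballot] using tailCount_succ_zero d
  | succ k ih =>
    have h := tailCount_succ_succ (n := k + d) (k := k) (by omega)
    rw [show k + 1 + d = k + d + 1 by omega, h, tailCount_eq_sum k k d le_rfl, ballot,
      sum_range_succ _ (d + 1), add_comm, add_assoc k d 1, ih]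
    simp only [ih]

lemma winCount_eq_sum_ballot (k d : ℕ) :
    winCount (k + d + 1) k = ∑ e ∈ range (d + 1), (e + 1) * ballot k e := by
  have h (m : ℕ) : ∑ j ∈ range (k + m), (if k ≤ j then tailCount (k + d) k j else 0) =
      ∑ j ∈ range m, tailCount (k + d) k (k + j) := by
    rw [sum_range_add, sum_eq_zero fun j hj => if_neg (by simpa using hj)]
    simp
  rw [winCount_succ, add_assoc, h]
  have h2 (j : ℕ) (hj : j ∈ range (d + 1)) : tailCount (k + d) k (k + j) =
      ∑ e ∈ range (d + 1), if j ≤ e then ballot k e else 0 := by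
    rw [mem_range] at hj
    obtain ⟨c, rfl⟩ := Nat.exists_eq_add_of_le (Nat.lt_succ_iff.1 hj)
    rw [← add_assoc, tailCount_eq_sum k (k + j) c (by omega), add_assoc j c 1, sum_range_add _ j,
      sum_eq_zero (s := range j) fun e he => if_neg (by simpa using he)]
    simp [add_assoc, tailCount_eq_ballot]
  rw [sum_congr rfl h2, sum_comm]
  refine sum_congr rfl fun e he => ?_
  rw [mem_range] at he
  rw [← sum_filter, sum_const, smul_eq_mul]
  congr 1
  rw [show (range (d + 1)).filter (· ≤ e) = range (e + 1) by ext; simp; omega, card_range]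

lemma winCount_of_le {N k : ℕ} (h : N ≤ k) : winCount N k = 0 := by
  have : IsEmpty {p : Equiv.Perm (Fin N) // Avoids321 p ∧ Winnable N k p} :=
    ⟨fun ⟨_, _, j, hj, _⟩ => by omega⟩
  exact Nat.card_of_isEmpty

lemma ballot_succ_zero (k : ℕ) : ballot (k + 1) 0 = ballot k 0 + ballot k 1 := by
  simp [ballot, sum_range_succ]

lemma ballot_succ_succ (k d : ℕ) :
    ballot (k + 1) (d + 1) = ballot (k + 1) d + ballot k (d + 2) := by
  rw [ballot, sum_range_succ, ballot]

lemma ballot_one (d : ℕ) : ballot 1 d = 1 := by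
  induction d with
  | zero => rfl
  | succ d ih => rw [ballot_succ_succ, ih]; rfl

lemma mul_ballot_succ_left (k : ℕ)
    (h : ∀ e : ℕ, ((e : ℚ) + 2) * (k + e + 2) * ballot k (e + 1) =
      (e + 3) * (2 * k + e) * ballot k e)
    (e : ℕ) :
    (k : ℚ) * (e + 3) * ballot (k + 1) e = (e + 2) * (2 * k + e + 1) * ballot k (e + 1) := by
  induction e with
  | zero =>
    have := h 0
    rw [ballot_succ_zero]
    push_cast at *
    linear_combination (-1 / 2 : ℚ) * this
  | succ e ih =>
    have := h (e + 1)
    rw [ballot_succ_succ]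
    push_cast at *
    have h3 : ((e : ℚ) + 3) ≠ 0 := by positivity
    apply mul_left_cancel₀ h3
    linear_combination ((e : ℚ) + 4) * ih - (e + 2) * this

lemma mul_ballot_succ (k e : ℕ) :
    ((e : ℚ) + 2) * (k + e + 2) * ballot k (e + 1) = (e + 3) * (2 * k + e) * ballot k e := by
  induction k generalizing e with
  | zero => cases e <;> simp [ballot]
  | succ k ih =>
    rcases k.eq_zero_or_pos with rfl | hk
    · simp [ballot_one]; ring
    have q0 := mul_ballot_succ_left k ih e
    have q1 := mul_ballot_succ_left k ih (e + 1)
    have r := ih (e + 1)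
    push_cast at *
    have hk : (k : ℚ) ≠ 0 := by positivity
    have h3 : ((e : ℚ) + 3) ≠ 0 := by positivity
    have h4 : ((e : ℚ) + 4) ≠ 0 := by positivity
    apply mul_left_cancel₀ (mul_ne_zero (mul_ne_zero hk h3) h4)
    linear_combination (e + 2) * (k + e + 3) * (e + 3) * q1 -
      (e + 3) * (e + 4) * (2 * k + e + 2) * q0 + (e + 2) * (e + 3) * (2 * k + e + 2) * r

lemma mul_ballot_succ_le (k e : ℕ) : (e + 2) * ballot k (e + 1) ≤ 2 * (e + 3) * ballot k e := by
  have h := mul_ballot_succ k e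
  have hpos : (0 : ℚ) < k + e + 2 := by positivity
  have : ((e : ℚ) + 2) * ballot k (e + 1) ≤ 2 * (e + 3) * ballot k e := by
    refine le_of_mul_le_mul_left ?_ hpos
    have : (0 : ℚ) ≤ (e + 3) * (e + 4) * ballot k e := by positivity
    linarith
  exact_mod_cast this

lemma add_two_mul_ballot_succ_le (k e : ℕ) (he : 1 ≤ e) :
    (e + 2) * ballot k (e + 1) ≤ (e + 1) * ballot (k + 1) e := by
  obtain ⟨e, rfl⟩ := Nat.exists_eq_add_of_le' he
  rw [ballot, sum_range_succ, sum_range_succ]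
  have h := mul_ballot_succ_le k (e + 1)
  rcases e.eq_zero_or_pos with rfl | he
  · have := mul_ballot_succ_le k 0
    simp at *
    omega
  · nlinarith [Nat.zero_le (∑ x ∈ range (e + 1), ballot k x)]

lemma winCount_le_succ (k d : ℕ) (hd : 2 ≤ d) :
    winCount (k + d + 2) k ≤ winCount (k + d + 2) (k + 1) := by
  have h1 := winCount_eq_sum_ballot k (d + 1)
  have h2 := winCount_eq_sum_ballot (k + 1) d
  rw [show k + (d + 1) + 1 = k + d + 2 by omega] at h1
  rw [show k + 1 + d + 1 = k + d + 2 by omega] at h2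
  rw [h1, h2]
  clear h1 h2
  induction d, hd using Nat.le_induction with
  | base =>
    have h0 := mul_ballot_succ_le k 1
    have h1 := mul_ballot_succ_le k 2
    simp [sum_range_succ, ballot] at *
    omega
  | succ d hd ih =>
    rw [sum_range_succ _ (d + 1 + 1),
      sum_range_succ (fun e => (e + 1) * ballot (k + 1) e) (d + 1)]
    exact add_le_add ih (add_two_mul_ballot_succ_le k (d + 1) (by omega))

lemma winCount_add_three_le (k d : ℕ) :
    winCount (k + d + 3) k ≤ winCount (k + d + 3) (k + d) := by
  induction d generalizing k with
  | zero => exact le_rfl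
  | succ d ih =>
    have h := ih (k + 1)
    rw [show k + 1 + d = k + (d + 1) by omega] at h
    exact (winCount_le_succ k (d + 2) (by omega)).trans h

lemma winCount_last_le (n : ℕ) : winCount (n + 2) (n + 1) ≤ winCount (n + 2) n := by
  have h1 := winCount_eq_sum_ballot n 1
  have h2 := winCount_eq_sum_ballot (n + 1) 0
  rw [h1, h2]
  simp [sum_range_succ, ballot_succ_zero]
  omega

lemma ballot_zero_right_pos (k : ℕ) : 0 < ballot k 0 := by
  induction k with
  | zero => simp [ballot]
  | succ k ih => rw [ballot_succ_zero]; omega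

lemma winCount_succ_le_iff (n : ℕ) :
    winCount (n + 3) (n + 1) ≤ winCount (n + 3) n ↔
      2 * ballot n 0 + ballot n 1 ≤ ballot n 2 := by
  have h1 := winCount_eq_sum_ballot n 2
  have h2 := winCount_eq_sum_ballot (n + 1) 1
  rw [show n + 1 + 1 + 1 = n + 3 by omega] at h2
  rw [show n + 2 + 1 = n + 3 by omega] at h1
  rw [h1, h2]
  simp [sum_range_succ, ballot]
  omega

lemma mul_ballot_two_sub (n : ℕ) :
    ((n : ℚ) + 2) * (n + 3) * (ballot n 2 - (2 * ballot n 0 + ballot n 1)) =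
      ballot n 0 * (3 * (n ^ 2 - 5 * n - 4)) := by
  have h0 := mul_ballot_succ n 0
  have h1 := mul_ballot_succ n 1
  norm_num at h0 h1
  linear_combination (n + 2) / 3 * h1 + (4 * (2 * n + 1) / 6 - (n + 3) / 2) * h0

lemma winCount_succ_le_iff_six_le (n : ℕ) :
    winCount (n + 3) (n + 1) ≤ winCount (n + 3) n ↔ 6 ≤ n := by
  rw [winCount_succ_le_iff]
  have h := mul_ballot_two_sub n
  have hf : (0 : ℚ) < ballot n 0 := by exact_mod_cast ballot_zero_right_pos n
  have hp : (0 : ℚ) < ((n : ℚ) + 2) * (n + 3) := by positivity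
  constructor
  · intro hle
    by_contra hn
    have hn : (n : ℚ) ≤ 5 := by exact_mod_cast (by omega : n ≤ 5)
    have hle : (0 : ℚ) ≤ ballot n 2 - (2 * ballot n 0 + ballot n 1) := by
      rw [sub_nonneg]; exact_mod_cast hle
    have hneg : (n : ℚ) ^ 2 - 5 * n - 4 < 0 := by nlinarith [(n.cast_nonneg : (0 : ℚ) ≤ n)]
    nlinarith [mul_nonneg hp.le hle]
  · intro hn
    have hn : (6 : ℚ) ≤ n := by exact_mod_cast hn
    have hnn : (0 : ℚ) ≤ (n : ℚ) ^ 2 - 5 * n - 4 := by nlinarith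
    have hle : (0 : ℚ) ≤ ballot n 2 - (2 * ballot n 0 + ballot n 1) :=
      nonneg_of_mul_nonneg_right (h ▸ by positivity) hp
    rw [sub_nonneg] at hle
    exact_mod_cast hle

lemma winCount_le_max (n k : ℕ) :
    winCount (n + 3) k ≤ max (winCount (n + 3) n) (winCount (n + 3) (n + 1)) := by
  rcases le_or_gt k n with hk | hk
  · obtain ⟨d, rfl⟩ := Nat.exists_eq_add_of_le hk
    exact le_max_of_le_left (winCount_add_three_le k d)
  · refine le_max_of_le_right ?_
    rcases le_or_gt (n + 3) k with h | h
    · simp [winCount_of_le h]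
    · obtain rfl | rfl : k = n + 1 ∨ k = n + 2 := by omega
      · exact le_rfl
      · exact winCount_last_le (n + 1)

end

/-- The optimal positional strategy for the game of best choice on 321-avoiding
interview orders of size `N` transitions at `k = N-1` when `N = 2`, at `k = N-2`
when `3 ≤ N ≤ 8`, and at `k = N-3` when `N ≥ 9`. -/
theorem optimal_positional_strategy_321 (N : ℕ) :
    (N = 2 → ∀ k : ℕ, winCount N k ≤ winCount N (N - 1)) ∧
    (3 ≤ N → N ≤ 8 → ∀ k : ℕ, winCount N k ≤ winCount N (N - 2)) ∧
    (9 ≤ N → ∀ k : ℕ, winCount N k ≤ winCount N (N - 3)) := by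
  refine ⟨?_, fun h3 h8 k => ?_, fun h9 k => ?_⟩
  · rintro rfl k
    rcases k with _ | _ | k
    · have h0 := winCount_eq_sum_ballot 0 1
      have h1 := winCount_eq_sum_ballot 1 0
      norm_num at h0 h1
      simp [h0, h1, Finset.sum_range_succ, ballot]
    · exact le_rfl
    · simp [winCount_of_le]
  · obtain ⟨n, rfl⟩ := Nat.exists_eq_add_of_le' h3
    have := winCount_succ_le_iff_six_le n
    exact (winCount_le_max n k).trans (max_le (by simp; omega) le_rfl)
  · obtain ⟨n, rfl⟩ := Nat.exists_eq_add_of_le' (show 3 ≤ N by omega)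
    exact (winCount_le_max n k).trans
      (max_le le_rfl ((winCount_succ_le_iff_six_le n).2 (by omega)))
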